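/- arXiv:math/0410429 — 3 statements merged into one kernel-verified Lean document; each statement's English description precedes it below -/
import Mathlib

section
/- The total activities of the single-seeded rule 150 automaton at the times 2^n − 1 satisfy the recursion χ(n) = 2·χ(n−1) − (−1)^n: for every n ≥ 1, (X(2^n − 1) : ℤ) = 2·X(2^(n−1) − 1) − (−1)^n. -/
/-- Rule 150 elementary cellular automaton, started from a single seed at the origin. -/
def rule150 : ℕ → ℤ → ZMod 2
  | 0, n => if n = 0 then 1 else 0
  | t + 1, n => rule150 t (n - 1) + rule150 t n + rule150 t (n + 1)

/-- Total activity: the number of active sites at time `t`. -/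
noncomputable def totalActivity (t : ℕ) : ℕ := {n : ℤ | rule150 t n = 1}.ncard

theorem rule150_add_two (t : ℕ) (k : ℤ) :
    rule150 (t + 2) k = rule150 t (k - 2) + rule150 t k + rule150 t (k + 2) := by
  have h2 : (2 : ZMod 2) = 0 := rfl
  simp only [rule150]
  rw [show k - 1 - 1 = k - 2 by ring, show k - 1 + 1 = k by ring, show k + 1 - 1 = k by ring,
    show k + 1 + 1 = k + 2 by ring]
  linear_combination (rule150 t (k - 1) + rule150 t k + rule150 t (k + 1)) * h2

theorem rule150_two_mul (t : ℕ) (k : ℤ) :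
    rule150 (2 * t) (2 * k) = rule150 t k ∧ rule150 (2 * t) (2 * k + 1) = 0 := by
  induction t generalizing k with
  | zero =>
    constructor
    · simp [rule150]
    · simp only [rule150, ite_eq_right_iff]
      omega
  | succ t ih =>
    rw [show 2 * (t + 1) = 2 * t + 2 by ring, rule150_add_two, rule150_add_two,
      show 2 * k - 2 = 2 * (k - 1) by ring, show 2 * k + 2 = 2 * (k + 1) by ring,
      show 2 * k + 1 - 2 = 2 * (k - 1) + 1 by ring,
      show 2 * k + 1 + 2 = 2 * (k + 1) + 1 by ring]
    simp [ih, rule150]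

theorem rule150_two_mul_add_one_even (t : ℕ) (k : ℤ) :
    rule150 (2 * t + 1) (2 * k) = rule150 t k := by
  rw [rule150, show 2 * k - 1 = 2 * (k - 1) + 1 by ring]
  simp [rule150_two_mul]

theorem rule150_two_mul_add_one_odd (t : ℕ) (k : ℤ) :
    rule150 (2 * t + 1) (2 * k + 1) = rule150 t k + rule150 t (k + 1) := by
  rw [rule150, show 2 * k + 1 - 1 = 2 * k by ring, show 2 * k + 1 + 1 = 2 * (k + 1) by ring]
  simp [rule150_two_mul]

/-- The active sites at time `m`, when `m + 1` is a power of two. -/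
noncomputable def mersenneSites (m : ℕ) : Finset ℤ :=
  (Finset.Icc (-m : ℤ) m).filter fun k => (m - k.natAbs) % 3 ≠ 2

theorem mem_mersenneSites {m : ℕ} {k : ℤ} :
    k ∈ mersenneSites m ↔ k.natAbs ≤ m ∧ (m - k.natAbs) % 3 ≠ 2 := by
  simp only [mersenneSites, Finset.mem_filter, Finset.mem_Icc]
  omega

theorem two_pow_succ_sub_one (n : ℕ) : 2 ^ (n + 1) - 1 = 2 * (2 ^ n - 1) + 1 := by
  have := Nat.one_le_two_pow (n := n)
  omega

theorem rule150_two_pow_sub_one (n : ℕ) (k : ℤ) :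
    rule150 (2 ^ n - 1) k = if k ∈ mersenneSites (2 ^ n - 1) then 1 else 0 := by
  induction n generalizing k with
  | zero =>
    simp only [mem_mersenneSites, pow_zero, Nat.sub_self, rule150]
    congr 1
    simp
  | succ n ih =>
    rw [two_pow_succ_sub_one]
    generalize 2 ^ n - 1 = m at ih
    obtain ⟨j, rfl | rfl⟩ := Int.even_or_odd' k
    · rw [rule150_two_mul_add_one_even, ih]
      simp only [mem_mersenneSites]
      congr 1
      apply propext
      omega
    · rw [rule150_two_mul_add_one_odd, ih, ih]
      simp only [mem_mersenneSites]
      have h3 : (m - j.natAbs) % 3 = 0 ∨ (m - j.natAbs) % 3 = 1 ∨ (m - j.natAbs) % 3 = 2 := by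
        omega
      split_ifs <;> first | rfl | (exfalso; rcases h3 with h3 | h3 | h3 <;> omega)

theorem totalActivity_two_pow_sub_one (n : ℕ) :
    totalActivity (2 ^ n - 1) = (mersenneSites (2 ^ n - 1)).card := by
  rw [totalActivity, ← Set.ncard_coe_finset]
  congr 1
  ext k
  simp [rule150_two_pow_sub_one]

theorem card_mersenneSites_add_three (m : ℕ) :
    (mersenneSites (m + 3)).card = (mersenneSites m).card + 4 := by
  have h : mersenneSites (m + 3) =
      mersenneSites m ∪ {(m + 3 : ℤ), -(m + 3 : ℤ), (m + 2 : ℤ), -(m + 2 : ℤ)} := by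
    ext k
    simp only [Finset.mem_union, mem_mersenneSites, Finset.mem_insert, Finset.mem_singleton]
    omega
  rw [h, Finset.card_union_of_disjoint]
  · congr 1
    repeat rw [Finset.card_insert_of_notMem
      (by simp only [Finset.mem_insert, Finset.mem_singleton]; omega)]
    rw [Finset.card_singleton]
  · rw [Finset.disjoint_left]
    intro k
    simp only [mem_mersenneSites, Finset.mem_insert, Finset.mem_singleton]
    omega

theorem card_mersenneSites_three_mul (q : ℕ) : (mersenneSites (3 * q)).card = 4 * q + 1 := by
  induction q with
  | zero => decide
  | succ q ih => rw [mul_add_one, card_mersenneSites_add_three, ih]; ring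

theorem card_mersenneSites_three_mul_add_one (q : ℕ) :
    (mersenneSites (3 * q + 1)).card = 4 * q + 3 := by
  induction q with
  | zero => decide
  | succ q ih =>
    rw [show 3 * (q + 1) + 1 = 3 * q + 1 + 3 by ring, card_mersenneSites_add_three, ih]; ring

theorem two_pow_sub_one_eq_three_mul (n : ℕ) :
    ∃ q, (2 ^ n - 1 = 3 * q ∧ (-1 : ℤ) ^ n = 1) ∨ (2 ^ n - 1 = 3 * q + 1 ∧ (-1 : ℤ) ^ n = -1) := by
  induction n with
  | zero => exact ⟨0, by simp⟩
  | succ n ih =>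
    obtain ⟨q, ⟨h, hs⟩ | ⟨h, hs⟩⟩ := ih
    · exact ⟨2 * q, Or.inr ⟨by rw [two_pow_succ_sub_one, h]; ring, by rw [pow_succ, hs]; rfl⟩⟩
    · exact ⟨2 * q + 1, Or.inl ⟨by rw [two_pow_succ_sub_one, h]; ring, by rw [pow_succ, hs]; rfl⟩⟩

theorem totalActivity_pow_two_sub_one_rec (n : ℕ) (hn : 1 ≤ n) :
    (totalActivity (2 ^ n - 1) : ℤ)
      = 2 * (totalActivity (2 ^ (n - 1) - 1) : ℤ) - (-1) ^ n := by
  obtain ⟨n, rfl⟩ := Nat.exists_eq_add_of_le' hn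
  rw [Nat.add_sub_cancel, totalActivity_two_pow_sub_one, totalActivity_two_pow_sub_one,
    two_pow_succ_sub_one, pow_succ]
  obtain ⟨q, ⟨h, hs⟩ | ⟨h, hs⟩⟩ := two_pow_sub_one_eq_three_mul n
  · rw [h, hs, show 2 * (3 * q) + 1 = 3 * (2 * q) + 1 by ring,
      card_mersenneSites_three_mul_add_one, card_mersenneSites_three_mul]
    push_cast
    ring
  · rw [h, hs, show 2 * (3 * q + 1) + 1 = 3 * (2 * q + 1) by ring,
      card_mersenneSites_three_mul_add_one, card_mersenneSites_three_mul]
    push_cast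
    ring
end

section
/- Second branch of the two-step (Fibonacci-like) iteration for the rule 150 total activity: for all n : ℕ and all t : ℕ with t < 2^n, X(2^(n+1) + 2^n + t) = X(2^n + t) + 2·X(t). -/
theorem rule150_eq_zero (t : ℕ) (k : ℤ) (hk : (t : ℤ) < |k|) : rule150 t k = 0 := by
  induction t generalizing k with
  | zero =>
    have : k ≠ 0 := by rintro rfl; simp at hk
    simp [rule150, this]
  | succ t ih =>
    push_cast at hk
    rw [rule150, ih (k - 1) (by grind), ih k (by grind), ih (k + 1) (by grind)]
    simp

theorem rule150_two_pow_add (n s : ℕ) (k : ℤ) :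
    rule150 (2 ^ n + s) k
      = rule150 s (k - 2 ^ n) + rule150 s k + rule150 s (k + 2 ^ n) := by
  induction n generalizing s k with
  | zero => rw [pow_zero, add_comm 1 s, rule150, pow_zero]
  | succ n ih =>
    have h2 : (2 : ZMod 2) = 0 := rfl
    rw [show 2 ^ (n + 1) + s = 2 ^ n + (2 ^ n + s) by ring, ih, ih, ih, ih,
      show k - 2 ^ n - 2 ^ n = k - 2 ^ (n + 1) by ring,
      show k + 2 ^ n + 2 ^ n = k + 2 ^ (n + 1) by ring, sub_add_cancel, add_sub_cancel_right]
    linear_combination (rule150 s (k - 2 ^ n) + rule150 s k + rule150 s (k + 2 ^ n)) * h2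

theorem Finset.sum_range_mul_eq_sum_sum (f : ℕ → ℕ) (m N : ℕ) :
    ∑ i ∈ Finset.range (m * N), f i
      = ∑ j ∈ Finset.range N, ∑ a ∈ Finset.range m, f (a * N + j) := by
  rw [Finset.sum_comm]
  induction m with
  | zero => simp
  | succ m ih => rw [Nat.succ_mul, Finset.sum_range_add, ih, Finset.sum_range_succ]

/-- The total activity counted along the residue classes modulo `N`. -/
theorem totalActivity_eq_sum (s N : ℕ) (hs : s < 4 * N) :
    totalActivity s
      = ∑ j ∈ Finset.range N, ∑ a ∈ Finset.range 8,
          (rule150 s ((j : ℤ) + ((a : ℤ) - 4) * N)).val := by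
  have hset : {k : ℤ | rule150 s k = 1}
      = (fun i : ℕ => (i : ℤ) - 4 * N) ''
        ((Finset.range (8 * N)).filter fun i => rule150 s ((i : ℤ) - 4 * N) = 1 : Finset ℕ) := by
    ext k
    simp only [Set.mem_ofPred_eq, Set.mem_image, Finset.coe_filter, Finset.mem_range]
    constructor
    · intro hk
      have hks : |k| ≤ s := by
        by_contra! h
        simp [rule150_eq_zero s k h] at hk
      have e : (((k + 4 * N).toNat : ℕ) : ℤ) - 4 * N = k := by grind
      exact ⟨(k + 4 * N).toNat, ⟨by grind, by rwa [e]⟩, e⟩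
    · rintro ⟨i, ⟨-, hi⟩, rfl⟩
      exact hi
  have hval : ∀ x : ZMod 2, (if x = 1 then 1 else 0) = x.val := by decide
  rw [totalActivity, hset, Set.ncard_image_of_injective _ (fun a b h => by simpa using h),
    Set.ncard_coe_finset, Finset.card_filter, Finset.sum_range_mul_eq_sum_sum]
  refine Finset.sum_congr rfl fun j _ => Finset.sum_congr rfl fun a _ => ?_
  rw [hval]
  congr 2
  push_cast
  ring

theorem totalActivity_second_branch (n t : ℕ) (ht : t < 2 ^ n) :
    totalActivity (2 ^ (n + 1) + 2 ^ n + t)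
      = totalActivity (2 ^ n + t) + 2 * totalActivity t := by
  have hp : 2 ^ (n + 1) = 2 * 2 ^ n := by ring
  rw [totalActivity_eq_sum _ (2 ^ n) (by omega), totalActivity_eq_sum _ (2 ^ n) (by omega),
    totalActivity_eq_sum t (2 ^ n) (by omega), Finset.mul_sum, ← Finset.sum_add_distrib]
  refine Finset.sum_congr rfl fun j hj => ?_
  rw [Finset.mem_range] at hj
  obtain ⟨F, hF⟩ : ∃ F : ℤ → ZMod 2, ∀ b : ℤ, rule150 t ((j : ℤ) + b * 2 ^ n) = F b :=
    ⟨_, fun _ => rfl⟩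
  have hF_zero : ∀ b : ℤ, b ≠ 0 → b ≠ -1 → F b = 0 := by
    intro b h0 h1
    rw [← hF]
    apply rule150_eq_zero
    zify at ht hj
    rcases (show 1 ≤ b ∨ b ≤ -2 by omega) with h | h
    · exact lt_abs.2 (Or.inl (by nlinarith))
    · exact lt_abs.2 (Or.inr (by nlinarith))
  have hG (b : ℤ) : rule150 (2 ^ n + t) ((j : ℤ) + b * 2 ^ n) = F (b - 1) + F b + F (b + 1) := by
    rw [rule150_two_pow_add, ← hF, ← hF, ← hF]
    ring_nf
  have hH (b : ℤ) : rule150 (2 ^ (n + 1) + 2 ^ n + t) ((j : ℤ) + b * 2 ^ n)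
      = (F (b - 3) + F (b - 2) + F (b - 1)) + (F (b - 1) + F b + F (b + 1))
        + (F (b + 1) + F (b + 2) + F (b + 3)) := by
    rw [add_assoc, rule150_two_pow_add,
      show (j : ℤ) + b * 2 ^ n - 2 ^ (n + 1) = j + (b - 2) * 2 ^ n by ring,
      show (j : ℤ) + b * 2 ^ n + 2 ^ (n + 1) = j + (b + 2) * 2 ^ n by ring, hG, hG, hG]
    ring_nf
  push_cast
  simp only [hF, hG, hH, Finset.sum_range_succ, Finset.sum_range_zero]
  norm_num [hF_zero]
  generalize F 0 = r
  generalize F (-1) = l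
  revert r l
  decide
end

section
/- Multiplicativity over zero-separated binary blocks in the simplest case: for the rule 150 total activity, for all natural numbers a and b with a < b, X(2^a + 2^b) = X(2^a) · X(2^b) = 9 whenever b ≥ a + 2, while for any n ≥ 1 and t = 0, X(2^n) = 3. -/
theorem rule150_eq_zero_of_lt_abs (t : ℕ) (n : ℤ) (h : (t : ℤ) < |n|) : rule150 t n = 0 := by
  induction t generalizing n with
  | zero =>
    have : n ≠ 0 := by rintro rfl; simp at h
    simp [rule150, this]
  | succ t ih =>
    have hn := lt_abs.1 h
    push_cast at hn
    rw [rule150, ih (n - 1) (lt_abs.2 (by omega)), ih n (lt_abs.2 (by omega)),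
      ih (n + 1) (lt_abs.2 (by omega))]
    simp

/-- Advancing `2 ^ k` steps is the rule 150 update at spacing `2 ^ k`. -/
theorem rule150_add_two_pow (k t : ℕ) (n : ℤ) :
    rule150 (t + 2 ^ k) n = rule150 t (n - 2 ^ k) + rule150 t n + rule150 t (n + 2 ^ k) := by
  induction k generalizing t n with
  | zero => simp [rule150]
  | succ k ih =>
    have h2 (x : ZMod 2) : x + x = 0 := CharTwo.add_self_eq_zero x
    rw [show t + 2 ^ (k + 1) = t + 2 ^ k + 2 ^ k by ring, ih, ih, ih, ih,
      show n - 2 ^ k - 2 ^ k = n - 2 ^ (k + 1) by ring,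
      show n + 2 ^ k + 2 ^ k = n + 2 ^ (k + 1) by ring,
      sub_add_cancel, add_sub_cancel_right]
    linear_combination h2 (rule150 t (n - 2 ^ k)) + h2 (rule150 t (n + 2 ^ k)) + h2 (rule150 t n)

theorem setOf_rule150_add_two_pow {k t : ℕ} (h : 2 * t < 2 ^ k) :
    {n : ℤ | rule150 (t + 2 ^ k) n = 1} =
      (· + (2 ^ k : ℤ)) '' {n | rule150 t n = 1} ∪
        ({n | rule150 t n = 1} ∪ (· - (2 ^ k : ℤ)) '' {n | rule150 t n = 1}) := by
  have hm : 2 * (t : ℤ) < 2 ^ k := by exact_mod_cast h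
  ext n
  have hl : (fun x : ℤ => x + 2 ^ k) '' {n | rule150 t n = 1} = {n | rule150 t (n - 2 ^ k) = 1} := by
    ext x; simp [sub_eq_add_neg]
  have hr : (fun x : ℤ => x - 2 ^ k) '' {n | rule150 t n = 1} = {n | rule150 t (n + 2 ^ k) = 1} := by
    ext x; simp [sub_eq_iff_eq_add]
  rw [hl, hr]
  simp only [Set.mem_union, Set.mem_ofPred_eq, rule150_add_two_pow]
  have z := rule150_eq_zero_of_lt_abs t
  rcases le_or_gt |n| (t : ℤ) with h0 | h0
  · have := abs_le.1 h0
    simp [z (n - 2 ^ k) (lt_abs.2 (by omega)), z (n + 2 ^ k) (lt_abs.2 (by omega))]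
  · rcases le_or_gt n 0 with h1 | h1
    · simp [z n h0, z (n - 2 ^ k) (lt_abs.2 (by omega))]
    · simp [z n h0, z (n + 2 ^ k) (lt_abs.2 (by omega))]

theorem totalActivity_add_two_pow {k t : ℕ} (h : 2 * t < 2 ^ k) :
    totalActivity (t + 2 ^ k) = 3 * totalActivity t := by
  have hm : 2 * (t : ℤ) < 2 ^ k := by exact_mod_cast h
  have bound {n : ℤ} (hn : rule150 t n = 1) : -(t : ℤ) ≤ n ∧ n ≤ t := by
    rw [← abs_le]
    by_contra! hlt
    simp [rule150_eq_zero_of_lt_abs t n hlt] at hn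
  have fin : {n : ℤ | rule150 t n = 1}.Finite :=
    (Set.finite_Icc (-(t : ℤ)) t).subset fun _ hn => bound hn
  rw [totalActivity, setOf_rule150_add_two_pow h,
    Set.ncard_union_eq _ (fin.image _) (fin.union (fin.image _)),
    Set.ncard_union_eq _ fin (fin.image _),
    Set.ncard_image_of_injective _ (add_left_injective _),
    Set.ncard_image_of_injective _ sub_left_injective, totalActivity]
  · ring
  · rw [Set.disjoint_left]
    rintro x hx ⟨y, hy, rfl⟩
    have := bound hx
    have := bound hy
    dsimp only at *
    omega
  · rw [Set.disjoint_left]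
    rintro _ ⟨y, hy, rfl⟩ (hx | ⟨x, hx, hxy⟩)
    · have := bound hx
      have := bound hy
      dsimp only at *
      omega
    · have := bound hx
      have := bound hy
      dsimp only at *
      omega

theorem totalActivity_zero : totalActivity 0 = 1 := by
  simp [totalActivity, rule150]

theorem totalActivity_two_pow (n : ℕ) : totalActivity (2 ^ n) = 3 := by
  simpa [totalActivity_zero] using totalActivity_add_two_pow (k := n) (t := 0) (by simp)

theorem totalActivity_block_multiplicativity :
    (∀ a b : ℕ, a < b → a + 2 ≤ b →
      totalActivity (2 ^ a + 2 ^ b) = totalActivity (2 ^ a) * totalActivity (2 ^ b)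
      ∧ totalActivity (2 ^ a + 2 ^ b) = 9)
    ∧ (∀ n : ℕ, 1 ≤ n → totalActivity (2 ^ n) = 3) := by
  refine ⟨fun a b _ hab => ?_, fun n _ => totalActivity_two_pow n⟩
  have h : 2 * 2 ^ a < 2 ^ b := by
    rw [← pow_succ']
    exact Nat.pow_lt_pow_right one_lt_two (by omega)
  simp [totalActivity_add_two_pow h, totalActivity_two_pow]
end
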